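/- arXiv:1008.2862 — 12 statements merged into one kernel-verified Lean document; each statement's English description precedes it below -/
import Mathlib

section
/- Let E be a real inner product space and L a ℤ-submodule of E such that ⟨x,x⟩ ≥ 4 for every nonzero x ∈ L. If v, k ∈ L satisfy k − v ∈ 2L, ⟨v,v⟩ ≤ 6 and ⟨k,k⟩ ≤ 8, then k = v or k = −v. (Thus a class of L/2L containing a vector of norm 4 or 6 contains no other vectors of norm at most 8 besides the pair ±v.) -/
open RealInnerProductSpace

/-- A class of `L/2L` containing a vector of norm 4 or 6 contains no other vectors
of norm at most 8 besides the pair `±v`. -/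
theorem stmt0 {E : Type*} [NormedAddCommGroup E] [InnerProductSpace ℝ E]
    (L : Submodule ℤ E) (hmin : ∀ x ∈ L, x ≠ 0 → (4 : ℝ) ≤ ⟪x, x⟫)
    (v k : E) (hv : v ∈ L) (hk : k ∈ L)
    (hclass : ∃ l ∈ L, k - v = (2 : ℤ) • l)
    (hv6 : ⟪v, v⟫ ≤ 6) (hk8 : ⟪k, k⟫ ≤ 8) :
    k = v ∨ k = -v := by
  obtain ⟨l, hl, hkl⟩ := hclass
  obtain rfl : k = v + (2 : ℤ) • l := by rw [← hkl]; abel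
  by_cases hl0 : l = 0
  · left
    simp [hl0]
  by_cases hs0 : v + l = 0
  · right
    rw [eq_neg_of_add_eq_zero_right hs0]
    abel
  have hdiff := hmin l hl hl0
  have hsum := hmin (v + l) (L.add_mem hv hl) hs0
  -- By the parallelogram law, the norms of `k - v` and `k + v` sum to at most 28 < 16 + 16.
  rw [two_zsmul] at hk8
  simp only [inner_add_left, inner_add_right] at hk8 hsum
  linarith [real_inner_comm v l]
end

section
/- Let E be a real inner product space and L a ℤ-submodule of E such that ⟨x,x⟩ ≥ 4 for every nonzero x ∈ L. If k₁, k₂ ∈ L satisfy k₁ − k₂ ∈ 2L, ⟨k₁,k₁⟩ = ⟨k₂,k₂⟩ = 8, k₁ ≠ k₂ and k₁ ≠ −k₂, then ⟨k₁,k₂⟩ = 0. (Thus the vectors of norm 8 in a fixed class of L/2L are pairwise orthogonal up to sign.) -/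
open RealInnerProductSpace

/-- The vectors of norm 8 in a fixed class of `L/2L` are pairwise orthogonal up to sign. -/
theorem stmt1 {E : Type*} [NormedAddCommGroup E] [InnerProductSpace ℝ E]
    (L : Submodule ℤ E) (hmin : ∀ x ∈ L, x ≠ 0 → (4 : ℝ) ≤ ⟪x, x⟫)
    (k₁ k₂ : E) (hk₁ : k₁ ∈ L) (hk₂ : k₂ ∈ L)
    (hclass : ∃ l ∈ L, k₁ - k₂ = (2 : ℤ) • l)
    (h₁ : ⟪k₁, k₁⟫ = 8) (h₂ : ⟪k₂, k₂⟫ = 8)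
    (hne : k₁ ≠ k₂) (hne' : k₁ ≠ -k₂) :
    ⟪k₁, k₂⟫ = 0 := by
  obtain ⟨l, hl, hkl⟩ := hclass
  obtain rfl : k₁ = k₂ + (l + l) := by
    rw [← two_zsmul, ← hkl, add_sub_cancel]
  have hl0 : l ≠ 0 := by
    rintro rfl
    exact hne (by simp)
  have hm0 : k₂ + l ≠ 0 := by
    intro h
    exact hne' (by rw [eq_neg_of_add_eq_zero_left h]; abel)
  have hl4 := hmin l hl hl0
  have hm4 := hmin (k₂ + l) (L.add_mem hk₂ hl) hm0
  simp only [inner_add_left, inner_add_right, real_inner_comm k₂ l] at h₁ hm4 ⊢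
  linarith
end

section
/- Let E be a finite-dimensional real inner product space and L a ℤ-submodule of E such that ⟨x,x⟩ ≥ 4 for every nonzero x ∈ L. Then for every v ∈ L the set {k ∈ L : k − v ∈ 2L and ⟨k,k⟩ = 8} is finite with at most 2·dim_ℝ(E) elements. -/
open RealInnerProductSpace

/-- A set of nonzero vectors in which any two members are equal, opposite or orthogonal has
at most `2 · dim E` elements. -/
theorem finite_and_ncard_le_of_eq_or_eq_neg_or_inner_eq_zero
    {E : Type*} [NormedAddCommGroup E] [InnerProductSpace ℝ E] [FiniteDimensional ℝ E]
    {S : Set E} (h0 : ∀ x ∈ S, x ≠ 0)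
    (h : ∀ x ∈ S, ∀ y ∈ S, x = y ∨ x = -y ∨ ⟪x, y⟫ = 0) :
    S.Finite ∧ S.ncard ≤ 2 * Module.finrank ℝ E := by
  obtain ⟨R, hRS, hR⟩ := Set.exists_subset_bijOn S (fun x : E => ({x, -x} : Set E))
  have hli : LinearIndependent ℝ (fun x : R => (x : E)) := by
    refine linearIndependent_of_ne_zero_of_inner_eq_zero (fun x => h0 x (hRS x.2)) ?_
    intro x y hxy
    have hne : (x : E) ≠ y := fun e => hxy (Subtype.ext e)
    rcases h x (hRS x.2) y (hRS y.2) with e | e | e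
    · exact absurd e hne
    · refine absurd (hR.injOn x.2 y.2 ?_) hne
      simp [e, Set.pair_comm]
    · exact e
  have hRfin : R.Finite := hli.setFinite
  have hRcard : R.ncard ≤ Module.finrank ℝ E := by
    have := hRfin.fintype
    rw [← Nat.card_coe_set_eq, Nat.card_eq_fintype_card]
    exact hli.fintype_card_le_finrank
  have hsub : S ⊆ R ∪ (fun x => -x) '' R := by
    intro x hx
    obtain ⟨r, hr, hrx⟩ := hR.surjOn ⟨x, hx, rfl⟩
    have hmem : x ∈ ({r, -r} : Set E) := by
      have hself : x ∈ ({x, -x} : Set E) := by simp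
      exact hrx.symm.subset hself
    rcases hmem with e | e
    · exact Or.inl (e ▸ hr)
    · exact Or.inr ⟨r, hr, e.symm⟩
  have hfin := hRfin.union (hRfin.image fun x => -x)
  refine ⟨hfin.subset hsub, ?_⟩
  have h1 := Set.ncard_le_ncard hsub hfin
  have h2 := Set.ncard_union_le R ((fun x => -x) '' R)
  have h3 := Set.ncard_image_le (f := fun x : E => -x) hRfin
  omega

/-- Twice a nonzero vector of a lattice with minimal norm at least `4` has norm at least `16`. -/
theorem sixteen_le_inner_two_zsmul
    {E : Type*} [NormedAddCommGroup E] [InnerProductSpace ℝ E]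
    {L : Submodule ℤ E} (hmin : ∀ x ∈ L, x ≠ 0 → (4 : ℝ) ≤ ⟪x, x⟫)
    {x l : E} (hl : l ∈ L) (hx : x = (2 : ℤ) • l) (hx0 : x ≠ 0) : 16 ≤ ⟪x, x⟫ := by
  have hl0 : l ≠ 0 := by
    rintro rfl
    simp [hx] at hx0
  have h4 := hmin l hl hl0
  have hx2 : x = l + l := by rw [hx, two_zsmul]
  rw [hx2, inner_add_left, inner_add_right]
  linarith

/-- The set of norm-8 vectors in a fixed class of `L/2L` is finite with at most
`2 · dim E` elements. -/
theorem stmt2 {E : Type*} [NormedAddCommGroup E] [InnerProductSpace ℝ E]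
    [FiniteDimensional ℝ E]
    (L : Submodule ℤ E) (hmin : ∀ x ∈ L, x ≠ 0 → (4 : ℝ) ≤ ⟪x, x⟫)
    (v : E) (hv : v ∈ L) :
    {k : E | k ∈ L ∧ (∃ l ∈ L, k - v = (2 : ℤ) • l) ∧ ⟪k, k⟫ = 8}.Finite ∧
    {k : E | k ∈ L ∧ (∃ l ∈ L, k - v = (2 : ℤ) • l) ∧ ⟪k, k⟫ = 8}.ncard ≤
      2 * Module.finrank ℝ E := by
  apply finite_and_ncard_le_of_eq_or_eq_neg_or_inner_eq_zero
  · rintro x ⟨-, -, hx⟩ rfl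
    simp at hx
  · rintro x ⟨-, ⟨a, ha, hxa⟩, hx⟩ y ⟨-, ⟨b, hb, hyb⟩, hy⟩
    by_cases hsub : x = y
    · exact Or.inl hsub
    by_cases hadd : x = -y
    · exact Or.inr (Or.inl hadd)
    refine Or.inr (Or.inr ?_)
    have h1 := sixteen_le_inner_two_zsmul hmin (x := x - y) (L.sub_mem ha hb)
      (by rw [smul_sub, ← hxa, ← hyb]; abel) (sub_ne_zero.mpr hsub)
    have h2 := sixteen_le_inner_two_zsmul hmin (x := x + y) (L.add_mem (L.add_mem ha hb) hv)
      (by rw [smul_add, smul_add, ← hxa, ← hyb, two_zsmul]; abel)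
      (fun e => hadd (eq_neg_of_add_eq_zero_left e))
    rw [real_inner_sub_sub_self] at h1
    rw [real_inner_add_add_self] at h2
    linarith
end

section
/- Let E be an n-dimensional real inner product space (n even), L a full even unimodular ℤ-lattice in E, and M a ℤ-submodule with 2L ⊆ M ⊆ L, of index [L : M] = 2^{n/2}, such that ⟨m,m⟩ ≡ 0 (mod 4) for all m ∈ M. Then M is even and unimodular with respect to the rescaled form ½⟨·,·⟩; that is, ½⟨m,m⟩ ∈ 2ℤ for all m ∈ M and {v ∈ E : ½⟨v,m⟩ ∈ ℤ for all m ∈ M} = M. -/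
open RealInnerProductSpace

/-- A finite abelian group has at most as many homomorphisms to a circle as it has elements. -/
lemma finite_and_card_addMonoidHom_addCircle_le {G : Type*} [AddCommGroup G] [Finite G] {T : ℝ}
    (hT : T ≠ 0) :
    Finite (G →+ AddCircle T) ∧ Nat.card (G →+ AddCircle T) ≤ Nat.card G := by
  have := Fintype.ofFinite G
  let Φ : (G →+ AddCircle T) → AddChar G ℂ := fun f ↦
    AddChar.circleEquivComplex (AddCircle.toCircle_addChar.compAddMonoidHom f)
  have hΦ : Function.Injective Φ := by
    intro f g h
    ext x
    have := DFunLike.congr_fun (AddChar.circleEquivComplex.injective h) x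
    exact AddCircle.injective_toCircle hT this
  refine ⟨Finite.of_injective Φ hΦ, ?_⟩
  calc Nat.card (G →+ AddCircle T) ≤ Nat.card (AddChar G ℂ) :=
        Nat.card_le_card_of_injective Φ hΦ
    _ = Nat.card G := by simp [Nat.card_eq_fintype_card]

/-- If `N` annihilates `K` under a circle-valued pairing, then the index in `N` of the
left kernel of the pairing is at most the index of `K`. -/
lemma relIndex_ker_le_index_of_pairing_eq_zero {A B : Type*} [AddCommGroup A] [AddCommGroup B]
    {T : ℝ} (hT : T ≠ 0) (β : A →+ B →+ AddCircle T) (N : AddSubgroup A) (K : AddSubgroup B)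
    [K.FiniteIndex] (h : ∀ a ∈ N, ∀ k ∈ K, β a k = 0) :
    β.ker.relIndex N ≤ K.index := by
  obtain ⟨_, hcard⟩ := finite_and_card_addMonoidHom_addCircle_le (G := B ⧸ K) hT
  rw [AddSubgroup.relIndex_ker]
  have hK : ∀ φ ∈ N.map β, K ≤ φ.ker := by
    rintro _ ⟨a, ha, rfl⟩ k hk
    exact h a ha k hk
  refine (Nat.card_le_card_of_injective
    (fun φ : N.map β ↦ QuotientAddGroup.lift K φ.1 (hK φ.1 φ.2)) ?_).trans hcard
  intro φ ψ hφψ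
  ext x
  exact DFunLike.congr_fun hφψ (x : B ⧸ K)

/-- The image of multiplication by `k` in a free abelian group of finite rank `n` has
index `k ^ n`. -/
lemma index_range_nsmul {A : Type*} [AddCommGroup A] [Module.Free ℤ A] [Module.Finite ℤ A]
    (k : ℕ) : (nsmulAddMonoidHom (α := A) k).range.index = k ^ Module.finrank ℤ A := by
  let b := Module.finBasis ℤ A
  let f : A →+ (Fin (Module.finrank ℤ A) → ZMod k) :=
    ((Int.castAddHom (ZMod k)).compLeft _).comp b.equivFun.toLinearMap.toAddMonoidHom
  have hf : Function.Surjective f :=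
    (Function.Surjective.comp_left (g := Int.cast) ZMod.intCast_surjective).comp
      b.equivFun.surjective
  have hker : f.ker = (nsmulAddMonoidHom (α := A) k).range := by
    ext a
    constructor
    · intro ha
      have hdvd : ∀ i, (k : ℤ) ∣ b.equivFun a i := fun i ↦
        (ZMod.intCast_zmod_eq_zero_iff_dvd _ k).mp (congrFun ha i)
      choose c hc using hdvd
      refine ⟨b.equivFun.symm c, b.equivFun.injective ?_⟩
      ext i
      simp [hc i, -Module.Basis.equivFun_apply]
    · rintro ⟨c, rfl⟩
      ext i
      simp [f]
  rw [← hker, AddSubgroup.index_ker, AddMonoidHom.range_eq_top.mpr hf]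
  simp [Nat.card_fun]

/-- The inner product of a real inner product space modulo `T`, restricted to a
`ℤ`-submodule. -/
noncomputable def innerModHom {E : Type*} [NormedAddCommGroup E] [InnerProductSpace ℝ E]
    (L : Submodule ℤ E) (T : ℝ) : L →+ L →+ AddCircle T :=
  AddMonoidHom.mk' (fun v ↦ AddMonoidHom.mk' (fun w ↦ ((⟪(v : E), (w : E)⟫ : ℝ) : AddCircle T))
    (fun w₁ w₂ ↦ by simp [inner_add_right]))
    (fun v₁ v₂ ↦ by ext w; simp [inner_add_left])

lemma innerModHom_eq_zero_iff {E : Type*} [NormedAddCommGroup E] [InnerProductSpace ℝ E]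
    (L : Submodule ℤ E) (T : ℝ) (v w : L) :
    innerModHom L T v w = 0 ↔ ∃ n : ℤ, ⟪(v : E), (w : E)⟫ = n * T := by
  simp only [innerModHom, AddMonoidHom.mk'_apply, AddCircle.coe_eq_zero_iff, zsmul_eq_mul]
  exact exists_congr fun _ ↦ eq_comm

/-- The preimage `M` in an even unimodular lattice `L` of a maximal totally isotropic
subspace of `(L/2L, q)` is, after rescaling the form by `½`, again even and unimodular. -/
theorem stmt5 {E : Type*} [NormedAddCommGroup E] [InnerProductSpace ℝ E]
    [FiniteDimensional ℝ E]
    (L M : Submodule ℤ E)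
    (hdisc : DiscreteTopology L)
    (hfull : Submodule.span ℝ (L : Set E) = ⊤)
    (heven : ∀ ℓ ∈ L, ∃ n : ℤ, ⟪ℓ, ℓ⟫ = 2 * n)
    (hunimod : ∀ v : E, (∀ ℓ ∈ L, ∃ n : ℤ, ⟪v, ℓ⟫ = n) ↔ v ∈ L)
    (hML : M ≤ L) (h2L : ∀ ℓ ∈ L, (2 : ℤ) • ℓ ∈ M)
    (hEeven : Even (Module.finrank ℝ E))
    (hindex : Nat.card (↥L ⧸ M.comap L.subtype) = 2 ^ (Module.finrank ℝ E / 2))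
    (hM4 : ∀ m ∈ M, ∃ n : ℤ, ⟪m, m⟫ = 4 * n) :
    (∀ m ∈ M, ∃ n : ℤ, (1 / 2 : ℝ) * ⟪m, m⟫ = 2 * n) ∧
    (∀ v : E, (∀ m ∈ M, ∃ n : ℤ, (1 / 2 : ℝ) * ⟪v, m⟫ = n) ↔ v ∈ M) := by
  have hMM : ∀ v ∈ M, ∀ m ∈ M, ∃ n : ℤ, (1 / 2 : ℝ) * ⟪v, m⟫ = n := by
    intro v hv m hm
    obtain ⟨a, ha⟩ := hM4 _ hv
    obtain ⟨b, hb⟩ := hM4 _ hm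
    obtain ⟨c, hc⟩ := hM4 _ (M.add_mem hv hm)
    refine ⟨c - a - b, ?_⟩
    rw [real_inner_add_add_self] at hc
    push_cast
    linarith
  refine ⟨fun m hm ↦ ?_, fun v ↦ ⟨fun hv ↦ ?_, hMM v⟩⟩
  · obtain ⟨n, hn⟩ := hM4 m hm
    exact ⟨n, by linarith⟩
  have : IsZLattice ℝ L := ⟨hfull⟩
  let β := innerModHom L 2
  let K : AddSubgroup L := (M.comap L.subtype).toAddSubgroup
  let N : AddSubgroup L :=
    { carrier := {x | ∀ k ∈ K, β x k = 0}
      zero_mem' := by simp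
      add_mem' := fun hx hy k hk ↦ by simp [hx k hk, hy k hk]
      neg_mem' := fun hx k hk ↦ by simp [hx k hk] }
  have hKindex : K.index = 2 ^ (Module.finrank ℝ E / 2) := hindex
  have : K.FiniteIndex := ⟨by rw [hKindex]; positivity⟩
  have hKN : K ≤ N := by
    intro x hx k hk
    obtain ⟨n, hn⟩ := hMM x hx k hk
    exact (innerModHom_eq_zero_iff L 2 x k).mpr ⟨n, by linarith⟩
  have hker : β.ker = (nsmulAddMonoidHom (α := L) 2).range := by
    ext x
    constructor
    · intro hx
      have hx' : (1 / 2 : ℝ) • (x : E) ∈ L := by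
        refine (hunimod _).mp fun ℓ hℓ ↦ ?_
        obtain ⟨n, hn⟩ := (innerModHom_eq_zero_iff L 2 x ⟨ℓ, hℓ⟩).mp (DFunLike.congr_fun hx _)
        exact ⟨n, by rw [real_inner_smul_left, hn]; ring⟩
      refine ⟨⟨_, hx'⟩, Subtype.ext ?_⟩
      simp [← Nat.cast_smul_eq_nsmul ℝ, smul_smul]
    · rintro ⟨y, rfl⟩
      ext w
      obtain ⟨n, hn⟩ := (hunimod y).mpr y.2 w w.2
      refine (innerModHom_eq_zero_iff L 2 _ w).mpr ⟨n, ?_⟩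
      simp [← Nat.cast_smul_eq_nsmul ℝ, real_inner_smul_left, hn, mul_comm]
  have hkerindex : β.ker.index = K.index * K.index := by
    rw [hker, index_range_nsmul, ZLattice.rank ℝ L, hKindex, ← pow_add]
    congr 1
    obtain ⟨r, hr⟩ := hEeven
    omega
  have hkerN : β.ker ≤ N := fun x hx k _ ↦ DFunLike.congr_fun hx k
  have hle : β.ker.relIndex N ≤ K.index :=
    relIndex_ker_le_index_of_pairing_eq_zero two_ne_zero β N K fun a ha ↦ ha
  have hNK : N ≤ K := by
    rw [← AddSubgroup.relIndex_eq_one]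
    have h₁ := AddSubgroup.relIndex_mul_index hkerN
    have h₂ := AddSubgroup.relIndex_mul_index hKN
    have hpos : 0 < K.index := Nat.pos_of_ne_zero AddSubgroup.FiniteIndex.index_ne_zero
    have hNindex : K.index ≤ N.index := by
      by_contra! hlt
      have := Nat.mul_le_mul_right N.index hle
      have := Nat.mul_lt_mul_of_pos_left hlt hpos
      omega
    have hNpos : 0 < N.index := hpos.trans_le hNindex
    have hne : K.relIndex N ≠ 0 := fun h0 ↦ by simp [h0] at h₂; omega
    by_contra hne1
    have : 2 ≤ K.relIndex N := by omega
    nlinarith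
  have hvL : v ∈ L := by
    refine (hunimod v).mp fun ℓ hℓ ↦ ?_
    obtain ⟨n, hn⟩ := hv _ (h2L ℓ hℓ)
    refine ⟨n, ?_⟩
    rw [← hn, ← Int.cast_smul_eq_zsmul ℝ, real_inner_smul_right]
    push_cast
    ring
  refine hNK (x := ⟨v, hvL⟩) fun k hk ↦ ?_
  obtain ⟨n, hn⟩ := hv k hk
  exact (innerModHom_eq_zero_iff L 2 ⟨v, hvL⟩ k).mpr ⟨n, by simp only; linarith⟩
end

section
/- Let E be a finite-dimensional real inner product space, L a full even unimodular ℤ-lattice in E, and M, N ⊆ L ℤ-submodules with M + N = L, M ∩ N = 2L, and ⟨m,m⟩ ≡ 0 (mod 4) for all m ∈ M and all m ∈ N. For an integer k ≥ 1 set L(M,N,k) := {(x₁+y, x₂+y, …, x_k+y) : y ∈ N, x₁,…,x_k ∈ M, x₁+⋯+x_k ∈ M ∩ N} ⊆ E^k, and equip E^k with the symmetric bilinear form B̃((u_i),(v_i)) := ½ Σ_{i=1}^k ⟨u_i, v_i⟩. Then L(M,N,k) is a full ℤ-lattice in E^k which is even and unimodular with respect to B̃: B̃(γ,γ) ∈ 2ℤ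 for every γ ∈ L(M,N,k), and {v ∈ E^k : B̃(v,γ) ∈ ℤ for all γ ∈ L(M,N,k)} = L(M,N,k). -/
open RealInnerProductSpace

/-- The `ℤ`-submodule `L(M,N,k)` of Quebbemann's construction, over an arbitrary finite index type
in place of `Fin k`. -/
def quebbemannSubmodule {E : Type*} [AddCommGroup E] (ι : Type*) [Fintype ι]
    (M N : Submodule ℤ E) : Submodule ℤ (ι → E) where
  carrier := {c | ∃ y ∈ N, ∃ x : ι → E,
    (∀ i, x i ∈ M) ∧ (∑ i, x i) ∈ M ⊓ N ∧ ∀ i, c i = x i + y}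
  zero_mem' := ⟨0, N.zero_mem, 0, fun _ => M.zero_mem, by simp, by simp⟩
  add_mem' := by
    rintro _ _ ⟨y, hy, x, hx, hs, hc⟩ ⟨y', hy', x', hx', hs', hc'⟩
    refine ⟨y + y', N.add_mem hy hy', x + x', fun i => M.add_mem (hx i) (hx' i), ?_, fun i => ?_⟩
    · simpa only [Pi.add_apply, Finset.sum_add_distrib] using (M ⊓ N).add_mem hs hs'
    · simp only [Pi.add_apply, hc, hc']
      abel
  smul_mem' := by
    rintro n _ ⟨y, hy, x, hx, hs, hc⟩
    refine ⟨n • y, N.smul_mem n hy, n • x, fun i => M.smul_mem n (hx i), ?_, fun i => ?_⟩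
    · simpa only [Pi.smul_apply, ← Finset.smul_sum] using (M ⊓ N).smul_mem n hs
    · simp only [Pi.smul_apply, hc, smul_add]

section Membership

variable {E ι : Type*} [AddCommGroup E] [Fintype ι]

theorem single_two_smul_mem_quebbemannSubmodule [DecidableEq ι] {L M N : Submodule ℤ E}
    (hcap : ∀ x : E, x ∈ M ⊓ N ↔ ∃ ℓ ∈ L, x = (2 : ℤ) • ℓ) (i : ι) {ℓ : E} (hℓ : ℓ ∈ L) :
    Pi.single i ((2 : ℤ) • ℓ) ∈ quebbemannSubmodule ι M N := by
  have h := (hcap _).2 ⟨ℓ, hℓ, rfl⟩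
  refine ⟨0, N.zero_mem, _, fun j => ?_, ?_, fun j => (add_zero _).symm⟩
  · rw [Pi.single_apply]
    split_ifs
    exacts [h.1, M.zero_mem]
  · rwa [Finset.sum_pi_single', if_pos (Finset.mem_univ i)]

theorem single_sub_single_mem_quebbemannSubmodule [DecidableEq ι] {M : Submodule ℤ E}
    (N : Submodule ℤ E) (i j : ι) {m : E} (hm : m ∈ M) :
    Pi.single i m - Pi.single j m ∈ quebbemannSubmodule ι M N := by
  have h (i l : ι) : (Pi.single i m : ι → E) l ∈ M := by
    rw [Pi.single_apply]
    split_ifs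
    exacts [hm, M.zero_mem]
  refine ⟨0, N.zero_mem, _, fun l => M.sub_mem (h i l) (h j l), ?_, fun l => (add_zero _).symm⟩
  simp [Finset.sum_sub_distrib]

theorem const_mem_quebbemannSubmodule (M : Submodule ℤ E) {N : Submodule ℤ E} {y : E}
    (hy : y ∈ N) : (fun _ => y) ∈ quebbemannSubmodule ι M N :=
  ⟨y, hy, 0, fun _ => M.zero_mem, by simp, by simp⟩

theorem quebbemannSubmodule_apply_mem {M N : Submodule ℤ E} {γ : ι → E}
    (hγ : γ ∈ quebbemannSubmodule ι M N) (i : ι) : γ i ∈ M ⊔ N := by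
  obtain ⟨y, hy, x, hx, -, hc⟩ := hγ
  rw [hc]
  exact Submodule.add_mem_sup (hx i) hy

theorem discreteTopology_quebbemannSubmodule [TopologicalSpace E] {M N : Submodule ℤ E}
    [DiscreteTopology (M ⊔ N : Submodule ℤ E)] :
    DiscreteTopology (quebbemannSubmodule ι M N) := by
  refine DiscreteTopology.of_continuous_injective
    (f := fun γ i => (⟨γ.1 i, quebbemannSubmodule_apply_mem γ.2 i⟩ : (M ⊔ N : Submodule ℤ E)))
    (continuous_pi fun i => ((continuous_apply i).comp continuous_subtype_val).subtype_mk _)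
    fun γ γ' h => Subtype.ext (funext fun i => ?_)
  exact congrArg Subtype.val (congrFun h i)

end Membership

section Polarisation

variable {E : Type*} [NormedAddCommGroup E] [InnerProductSpace ℝ E]

/-- If all norms in `M` are divisible by `4`, then all inner products in `M` are even. -/
theorem exists_inner_eq_two_mul {M : Submodule ℤ E}
    (hM4 : ∀ m ∈ M, ∃ n : ℤ, ⟪m, m⟫ = 4 * n) {x y : E} (hx : x ∈ M) (hy : y ∈ M) :
    ∃ n : ℤ, ⟪x, y⟫ = 2 * n := by
  obtain ⟨a, ha⟩ := hM4 _ (M.add_mem hx hy)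
  obtain ⟨b, hb⟩ := hM4 x hx
  obtain ⟨c, hc⟩ := hM4 y hy
  rw [real_inner_add_add_self] at ha
  refine ⟨a - b - c, ?_⟩
  push_cast
  linarith

/-- In a polarised unimodular lattice, `M` contains every lattice vector whose inner products
with `M` are all even. -/
theorem mem_of_forall_inner_even {L M N : Submodule ℤ E}
    (hunimod : ∀ v : E, (∀ ℓ ∈ L, ∃ n : ℤ, ⟪v, ℓ⟫ = n) ↔ v ∈ L)
    (hMN : M ⊔ N = L)
    (hcap : ∀ x : E, x ∈ M ⊓ N ↔ ∃ ℓ ∈ L, x = (2 : ℤ) • ℓ)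
    (hM4 : ∀ m ∈ M, ∃ n : ℤ, ⟪m, m⟫ = 4 * n)
    (hN4 : ∀ m ∈ N, ∃ n : ℤ, ⟪m, m⟫ = 4 * n)
    {v : E} (hv : v ∈ L) (h : ∀ m ∈ M, ∃ n : ℤ, ⟪v, m⟫ = 2 * n) : v ∈ M := by
  subst hMN
  obtain ⟨p, hp, q, hq, rfl⟩ := Submodule.mem_sup.1 hv
  refine M.add_mem hp ((hcap q).2 ⟨(1 / 2 : ℝ) • q, (hunimod _).1 fun ℓ hℓ => ?_, ?_⟩).1
  · obtain ⟨m, hm, n, hn, rfl⟩ := Submodule.mem_sup.1 hℓ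
    obtain ⟨a, ha⟩ := h m hm
    obtain ⟨b, hb⟩ := exists_inner_eq_two_mul hM4 hp hm
    obtain ⟨c, hc⟩ := exists_inner_eq_two_mul hN4 hq hn
    refine ⟨a - b + c, ?_⟩
    rw [inner_add_left] at ha
    rw [real_inner_smul_left, inner_add_right]
    push_cast
    linarith
  · rw [← Int.cast_smul_eq_zsmul ℝ, smul_smul]
    norm_num

variable {ι : Type*} [Fintype ι]

theorem quebbemannSubmodule_even {M N : Submodule ℤ E}
    (hM4 : ∀ m ∈ M, ∃ n : ℤ, ⟪m, m⟫ = 4 * n)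
    (hN4 : ∀ m ∈ N, ∃ n : ℤ, ⟪m, m⟫ = 4 * n)
    {γ : ι → E} (hγ : γ ∈ quebbemannSubmodule ι M N) :
    ∃ n : ℤ, (1 / 2 : ℝ) * ∑ i, ⟪γ i, γ i⟫ = 2 * n := by
  obtain ⟨y, hy, x, hx, hs, hc⟩ := hγ
  choose a ha using fun i => hM4 (x i) (hx i)
  obtain ⟨b, hb⟩ := exists_inner_eq_two_mul hN4 hs.2 hy
  obtain ⟨c, hc'⟩ := hN4 y hy
  refine ⟨∑ i, a i + b + Fintype.card ι * c, ?_⟩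
  simp only [hc, real_inner_add_add_self, Finset.sum_add_distrib, ← Finset.mul_sum, ha,
    ← sum_inner, hb, hc', Finset.sum_const, Finset.card_univ, nsmul_eq_mul]
  push_cast
  ring

theorem quebbemannSubmodule_integral {M N : Submodule ℤ E}
    (hM4 : ∀ m ∈ M, ∃ n : ℤ, ⟪m, m⟫ = 4 * n)
    (hN4 : ∀ m ∈ N, ∃ n : ℤ, ⟪m, m⟫ = 4 * n)
    {v γ : ι → E} (hv : v ∈ quebbemannSubmodule ι M N) (hγ : γ ∈ quebbemannSubmodule ι M N) :
    ∃ n : ℤ, (1 / 2 : ℝ) * ∑ i, ⟪v i, γ i⟫ = n := by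
  obtain ⟨a, ha⟩ := quebbemannSubmodule_even hM4 hN4 (add_mem hv hγ)
  obtain ⟨b, hb⟩ := quebbemannSubmodule_even hM4 hN4 hv
  obtain ⟨c, hc⟩ := quebbemannSubmodule_even hM4 hN4 hγ
  simp only [Pi.add_apply, real_inner_add_add_self, Finset.sum_add_distrib,
    ← Finset.mul_sum] at ha
  refine ⟨a - b - c, ?_⟩
  push_cast
  linarith

theorem span_quebbemannSubmodule {L M N : Submodule ℤ E}
    (hfull : Submodule.span ℝ (L : Set E) = ⊤)
    (hcap : ∀ x : E, x ∈ M ⊓ N ↔ ∃ ℓ ∈ L, x = (2 : ℤ) • ℓ) :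
    Submodule.span ℝ (quebbemannSubmodule ι M N : Set (ι → E)) = ⊤ := by
  classical
  set S := Submodule.span ℝ (quebbemannSubmodule ι M N : Set (ι → E))
  have hsingle (i : ι) : (⊤ : Submodule ℝ E) ≤ S.comap (LinearMap.single ℝ (fun _ => E) i) := by
    rw [← hfull, Submodule.span_le]
    intro ℓ hℓ
    have h : Pi.single i ((2 : ℤ) • ℓ) ∈ S :=
      Submodule.subset_span (single_two_smul_mem_quebbemannSubmodule hcap i hℓ)
    have h' := S.smul_mem (1 / 2 : ℝ) h
    rw [← Pi.single_smul, ← Int.cast_smul_eq_zsmul ℝ, smul_smul] at h'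
    norm_num at h'
    exact h'
  refine eq_top_iff.2 fun v _ => ?_
  rw [← Finset.univ_sum_single v]
  exact S.sum_mem fun i _ => hsingle i (Submodule.mem_top (x := v i))

/-- The dual of `L(M,N,k)` with respect to half the standard form is contained in `L(M,N,k)`. -/
theorem mem_quebbemannSubmodule_of_forall_inner [Nonempty ι] {L M N : Submodule ℤ E}
    (hunimod : ∀ v : E, (∀ ℓ ∈ L, ∃ n : ℤ, ⟪v, ℓ⟫ = n) ↔ v ∈ L)
    (hMN : M ⊔ N = L)
    (hcap : ∀ x : E, x ∈ M ⊓ N ↔ ∃ ℓ ∈ L, x = (2 : ℤ) • ℓ)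
    (hM4 : ∀ m ∈ M, ∃ n : ℤ, ⟪m, m⟫ = 4 * n)
    (hN4 : ∀ m ∈ N, ∃ n : ℤ, ⟪m, m⟫ = 4 * n) {v : ι → E}
    (h : ∀ γ ∈ quebbemannSubmodule ι M N, ∃ n : ℤ, (1 / 2 : ℝ) * ∑ i, ⟪v i, γ i⟫ = n) :
    v ∈ quebbemannSubmodule ι M N := by
  classical
  have hsum (i : ι) (e : E) : ∑ j, ⟪v j, (Pi.single i e : ι → E) j⟫ = ⟪v i, e⟫ := by
    rw [Finset.sum_eq_single i (fun j _ hj => by rw [Pi.single_eq_of_ne hj, inner_zero_right])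
      (by simp), Pi.single_eq_same]
  have hL (i : ι) : v i ∈ L := by
    refine (hunimod _).1 fun ℓ hℓ => ?_
    obtain ⟨n, hn⟩ := h _ (single_two_smul_mem_quebbemannSubmodule hcap i hℓ)
    refine ⟨n, ?_⟩
    rw [hsum, ← Int.cast_smul_eq_zsmul ℝ, real_inner_smul_right] at hn
    push_cast at hn
    linarith
  have hM (i j : ι) : v i - v j ∈ M := by
    refine mem_of_forall_inner_even hunimod hMN hcap hM4 hN4 (L.sub_mem (hL i) (hL j))
      fun m hm => ?_
    obtain ⟨n, hn⟩ := h _ (single_sub_single_mem_quebbemannSubmodule N i j hm)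
    simp only [Pi.sub_apply, inner_sub_right, Finset.sum_sub_distrib, hsum] at hn
    refine ⟨n, ?_⟩
    rw [inner_sub_left]
    linarith
  obtain ⟨j⟩ := ‹Nonempty ι›
  obtain ⟨p, hp, y, hy, hpy⟩ := Submodule.mem_sup.1 (hMN ▸ hL j : v j ∈ M ⊔ N)
  have hx (i : ι) : v i - y ∈ M := by
    convert M.add_mem (hM i j) hp using 1
    rw [← hpy]
    abel
  have hxM : ∑ i, (v i - y) ∈ M := M.sum_mem fun i _ => hx i
  refine ⟨y, hy, fun i => v i - y, hx, ⟨hxM, ?_⟩, fun i => (sub_add_cancel _ _).symm⟩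
  refine mem_of_forall_inner_even hunimod (sup_comm N M ▸ hMN)
    (fun x => by rw [inf_comm, hcap]) hN4 hM4 (hMN ▸ Submodule.mem_sup_left hxM) fun z hz => ?_
  obtain ⟨n, hn⟩ := h _ (const_mem_quebbemannSubmodule M hz)
  obtain ⟨b, hb⟩ := exists_inner_eq_two_mul hN4 hy hz
  refine ⟨n - Fintype.card ι * b, ?_⟩
  rw [sum_inner]
  simp only [inner_sub_left, Finset.sum_sub_distrib, hb, Finset.sum_const,
    Finset.card_univ, nsmul_eq_mul]
  push_cast
  linarith

end Polarisation

/-- Quebbemann's construction: for a polarisation `(M, N)` of an even unimodular lattice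
`L` and `k ≥ 1`, the lattice `L(M,N,k)` is a full `ℤ`-lattice in `E^k` which is even and
unimodular with respect to the form `B̃((uᵢ),(vᵢ)) = ½ Σ ⟪uᵢ, vᵢ⟫`. -/
theorem stmt6 {E : Type*} [NormedAddCommGroup E] [InnerProductSpace ℝ E]
    [FiniteDimensional ℝ E]
    (L M N : Submodule ℤ E)
    (hdisc : DiscreteTopology L)
    (hfull : Submodule.span ℝ (L : Set E) = ⊤)
    (heven : ∀ ℓ ∈ L, ∃ n : ℤ, ⟪ℓ, ℓ⟫ = 2 * n)
    (hunimod : ∀ v : E, (∀ ℓ ∈ L, ∃ n : ℤ, ⟪v, ℓ⟫ = n) ↔ v ∈ L)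
    (hMN : M ⊔ N = L)
    (hcap : ∀ x : E, x ∈ M ⊓ N ↔ ∃ ℓ ∈ L, x = (2 : ℤ) • ℓ)
    (hM4 : ∀ m ∈ M, ∃ n : ℤ, ⟪m, m⟫ = 4 * n)
    (hN4 : ∀ m ∈ N, ∃ n : ℤ, ⟪m, m⟫ = 4 * n)
    (k : ℕ) (hk : 1 ≤ k)
    (Γ : Set (Fin k → E))
    (hΓ : Γ = {c | ∃ y ∈ N, ∃ x : Fin k → E,
      (∀ i, x i ∈ M) ∧ (∑ i, x i) ∈ M ⊓ N ∧ ∀ i, c i = x i + y}) :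
    (∃ S : Submodule ℤ (Fin k → E), ↑S = Γ) ∧
    DiscreteTopology Γ ∧
    Submodule.span ℝ Γ = ⊤ ∧
    (∀ γ ∈ Γ, ∃ n : ℤ, (1 / 2 : ℝ) * ∑ i, ⟪γ i, γ i⟫ = 2 * n) ∧
    (∀ v : Fin k → E, (∀ γ ∈ Γ, ∃ n : ℤ, (1 / 2 : ℝ) * ∑ i, ⟪v i, γ i⟫ = n) ↔ v ∈ Γ) := by
  subst hMN
  have : Nonempty (Fin k) := Fin.pos_iff_nonempty.1 hk
  obtain rfl : Γ = quebbemannSubmodule (Fin k) M N := hΓ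
  exact ⟨⟨_, rfl⟩, discreteTopology_quebbemannSubmodule, span_quebbemannSubmodule hfull hcap,
    fun γ hγ => quebbemannSubmodule_even hM4 hN4 hγ,
    fun v => ⟨mem_quebbemannSubmodule_of_forall_inner hunimod rfl hcap hM4 hN4,
      fun hv γ hγ => quebbemannSubmodule_integral hM4 hN4 hv hγ⟩⟩
end

section
/- Let K = ℚ(√−7), σ its nontrivial automorphism, O_K its ring of integers, α = (1+√−7)/2 and β = 1 − α = σ(α). Let h be the Hermitian form on K³ given by h(a,b) = ½·Σ_{i=1}^{3} a_i·σ(b_i), and let P_b ⊆ K³ be the O_K-submodule generated by (β,β,0), (0,β,β), (α,α,α) (the Barnes lattice). Then P_b also equals the O_K-submodule generated by (1,1,α), (0,β,β), (0,0,2), and P_b is Hermitian unimodular: {v ∈ K³ : h(v,ℓ) ∈ O_K for all ℓ ∈ P_b} = P_b. -/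
theorem isIntegral_of_sq_sub_self_add_two {R : Type*} [CommRing R] {x : R}
    (hx : x ^ 2 - x + 2 = 0) : IsIntegral ℤ x := by
  refine ⟨Polynomial.X ^ 2 - Polynomial.X + 2, by monicity!, ?_⟩
  simpa [Polynomial.eval₂_sub] using hx

theorem Subalgebra.mem_span_triple_pi {R A : Type*} [CommRing R] [CommRing A] [Algebra R A]
    (S : Subalgebra R A) {ι : Type*} {p q r v : ι → A} :
    v ∈ Submodule.span S {p, q, r} ↔
      ∃ a ∈ S, ∃ b ∈ S, ∃ c ∈ S, ∀ i, v i = a * p i + b * q i + c * r i := by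
  rw [Submodule.mem_span_triple]
  constructor
  · rintro ⟨a, b, c, rfl⟩
    exact ⟨a, a.2, b, b.2, c, c.2, fun i => by simp [Subalgebra.smul_def]⟩
  · rintro ⟨a, ha, b, hb, c, hc, hv⟩
    exact ⟨⟨a, ha⟩, ⟨b, hb⟩, ⟨c, hc⟩, funext fun i => by simp [Subalgebra.smul_def, hv]⟩

/-- The Barnes lattice `P_b ⊆ K³`, `K = ℚ(√-7)`, generated over `O_K` by
`(β,β,0), (0,β,β), (α,α,α)` (with `α = (1+√-7)/2`, `β = 1-α`) is also generated by
`(1,1,α), (0,β,β), (0,0,2)`, and is Hermitian unimodular for the form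
`h(a,b) = ½ Σ aᵢ σ(bᵢ)`. -/
theorem stmt9 {K : Type*} [Field K] [Algebra ℚ K]
    (hdim : Module.finrank ℚ K = 2)
    (θ : K) (hθ : θ ^ 2 = -7)
    (σ : K ≃ₐ[ℚ] K) (hσθ : σ θ = -θ)
    (α β : K) (hα : α = (1 + θ) / 2) (hβ : β = 1 - α)
    (h : (Fin 3 → K) → (Fin 3 → K) → K)
    (hdef : ∀ a b, h a b = (1 / 2 : K) * ∑ i, a i * σ (b i))
    (Pb : Submodule (integralClosure ℤ K) (Fin 3 → K))
    (hPb : Pb = Submodule.span (integralClosure ℤ K)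
      {![β, β, 0], ![0, β, β], ![α, α, α]}) :
    Pb = Submodule.span (integralClosure ℤ K) {![1, 1, α], ![0, β, β], ![0, 0, 2]} ∧
    {v : Fin 3 → K | ∀ ℓ ∈ Pb, h v ℓ ∈ integralClosure ℤ K} = (Pb : Set (Fin 3 → K)) := by
  have : CharZero K := algebraRat.charZero K
  have hα2 : α ^ 2 - α + 2 = 0 := by
    rw [hα]; linear_combination hθ / 4
  have hβ2 : β ^ 2 - β + 2 = 0 := by
    rw [hβ]; linear_combination hα2
  have hσα : σ α = β := by
    rw [hβ, hα, map_div₀, map_add, hσθ, map_one, map_ofNat]; ring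
  have hσβ : σ β = α := by
    rw [hβ, map_sub, hσα, map_one, hβ]; ring
  have mα : α ∈ integralClosure ℤ K := isIntegral_of_sq_sub_self_add_two hα2
  have mβ : β ∈ integralClosure ℤ K := isIntegral_of_sq_sub_self_add_two hβ2
  have m2 : (2 : K) ∈ integralClosure ℤ K := ofNat_mem _ 2
  have mσ : ∀ {x}, x ∈ integralClosure ℤ K → σ x ∈ integralClosure ℤ K := fun {x} hx =>
    IsIntegral.map (σ.toAlgHom.restrictScalars ℤ) (show IsIntegral ℤ x from hx)
  have hspan : Pb = Submodule.span (integralClosure ℤ K) {![1, 1, α], ![0, β, β], ![0, 0, 2]} := by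
    rw [hPb]
    apply le_antisymm <;> rw [Submodule.span_le] <;> rintro _ (rfl | rfl | rfl) <;>
      rw [SetLike.mem_coe, Subalgebra.mem_span_triple_pi]
    · refine ⟨β, mβ, 0, zero_mem _, -1, neg_mem (one_mem _), ?_⟩
      simp [Fin.forall_fin_succ]
      linear_combination hα2 - α * hβ
    · exact ⟨0, zero_mem _, 1, one_mem _, 0, zero_mem _, by simp⟩
    · refine ⟨α, mα, 0, zero_mem _, 1, one_mem _, ?_⟩
      simp [Fin.forall_fin_succ]
      linear_combination -hα2
    · refine ⟨1, one_mem _, 0, zero_mem _, 1, one_mem _, ?_⟩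
      simp [Fin.forall_fin_succ, hβ]
    · exact ⟨0, zero_mem _, 1, one_mem _, 0, zero_mem _, by simp⟩
    · refine ⟨-α, neg_mem mα, 0, zero_mem _, β, mβ, ?_⟩
      simp [Fin.forall_fin_succ, mul_comm]
      linear_combination hα2 - α * hβ
  refine ⟨hspan, Set.ext fun v => ?_⟩
  rw [hspan]
  simp only [Set.mem_ofPred_eq, SetLike.mem_coe]
  constructor
  · intro hv
    have hw := hv ![1, 1, α] (Submodule.subset_span (by simp))
    have hu := hv ![0, β, β] (Submodule.subset_span (by simp))
    have ht := hv ![0, 0, 2] (Submodule.subset_span (by simp))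
    simp only [hdef, Fin.sum_univ_three, Matrix.cons_val, map_zero, map_one, map_ofNat, hσα,
      hσβ] at hw hu ht
    generalize hwe : (1 / 2 : K) * (v 0 * 1 + v 1 * 1 + v 2 * β) = w at hw
    generalize hue : (1 / 2 : K) * (v 0 * 0 + v 1 * α + v 2 * α) = u at hu
    generalize hte : (1 / 2 : K) * (v 0 * 0 + v 1 * 0 + v 2 * 2) = t at ht
    have h2 : v 2 = t := by linear_combination hte
    have h1 : v 1 = β * u - t := by
      linear_combination β * hue - h2 - (v 1 + v 2) / 2 * (α * hβ - hα2)
    have h0 : v 0 = 2 * w - β * u + α * t := by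
      linear_combination 2 * hwe - h1 - β * h2 - t * hβ
    rw [Subalgebra.mem_span_triple_pi]
    refine ⟨2 * w - β * u + α * t, ?_, 2 * u + β * t - α * w, ?_,
      2 * t - α * w + u - β * u + w, ?_, ?_⟩
    · exact add_mem (sub_mem (mul_mem m2 hw) (mul_mem mβ hu)) (mul_mem mα ht)
    · exact sub_mem (add_mem (mul_mem m2 hu) (mul_mem mβ ht)) (mul_mem mα hw)
    · exact add_mem (sub_mem (add_mem (sub_mem (mul_mem m2 ht) (mul_mem mα hw)) hu)
        (mul_mem mβ hu)) hw
    · simp only [Fin.forall_fin_succ, IsEmpty.forall_iff, and_true]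
      refine ⟨?_, ?_, ?_⟩
      · simp [h0]
      · simp [h1]
        subst hβ
        linear_combination (-w - t) * hα2
      · simp [h2]
        subst hβ
        linear_combination (-u - w - 2 * t) * hα2
  · intro hv ℓ hℓ
    rw [Subalgebra.mem_span_triple_pi] at hv hℓ
    obtain ⟨x, hx, y, hy, z, hz, hv⟩ := hv
    obtain ⟨a, ha, b, hb, c, hc, hℓ⟩ := hℓ
    have key : h v ℓ = x * (2 * σ a - β * σ b + α * σ c) + y * (-α * σ a + 2 * σ b + β * σ c)
        + z * (β * σ a + α * σ b + 2 * σ c) := by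
      simp only [hdef, Fin.sum_univ_three, hv, hℓ, Matrix.cons_val, map_add, map_mul, map_zero,
        map_one, map_ofNat, hσα, hσβ]
      generalize σ a = a'
      generalize σ b = b'
      generalize σ c = c'
      subst hβ
      linear_combination (-x * a' / 2 + x * b' / 2 + y * a' / 2 - y * b') * hα2
    rw [key]
    have ha' := mσ ha
    have hb' := mσ hb
    have hc' := mσ hc
    refine add_mem (add_mem (mul_mem hx ?_) (mul_mem hy ?_)) (mul_mem hz ?_)
    · exact add_mem (sub_mem (mul_mem m2 ha') (mul_mem mβ hb')) (mul_mem mα hc')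
    · exact add_mem (add_mem (mul_mem (neg_mem mα) ha') (mul_mem m2 hb')) (mul_mem mβ hc')
    · exact add_mem (add_mem (mul_mem mβ ha') (mul_mem mα hb')) (mul_mem m2 hc')
end

section
/- Let L be a ℤ-module and M, N ⊆ L submodules with M + N = L. Then {(x₁+y, x₂+y, x₃+y) : y ∈ N, x₁,x₂,x₃ ∈ M, x₁+x₂+x₃ ∈ M ∩ N} = {(c₁,c₂,c₃) ∈ L³ : c₁ − c₂ ∈ M, c₂ − c₃ ∈ M, and c₁ + c₂ + c₃ ∈ N}. -/
/-- Membership characterization of the lattice `L(M,N,3)` of Quebbemann's construction: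
if `M + N = L` then the set of triples `(x₁+y, x₂+y, x₃+y)` with `y ∈ N`, `xᵢ ∈ M`,
`x₁+x₂+x₃ ∈ M ∩ N` equals the set of `(c₁,c₂,c₃) ∈ L³` with `c₁-c₂ ∈ M`, `c₂-c₃ ∈ M`
and `c₁+c₂+c₃ ∈ N`. -/
theorem stmt13 {L : Type*} [AddCommGroup L] [Module ℤ L]
    (M N : Submodule ℤ L) (hMN : M ⊔ N = ⊤) :
    {p : L × L × L | ∃ y ∈ N, ∃ x₁ ∈ M, ∃ x₂ ∈ M, ∃ x₃ ∈ M,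
      x₁ + x₂ + x₃ ∈ M ⊓ N ∧ p = (x₁ + y, x₂ + y, x₃ + y)} =
    {p : L × L × L | p.1 - p.2.1 ∈ M ∧ p.2.1 - p.2.2 ∈ M ∧ p.1 + p.2.1 + p.2.2 ∈ N} := by
  ext ⟨c₁, c₂, c₃⟩
  simp only [Set.mem_ofPred_eq, Prod.mk.injEq]
  constructor
  · rintro ⟨y, hy, x₁, h₁, x₂, h₂, x₃, h₃, hsum, rfl, rfl, rfl⟩
    refine ⟨?_, ?_, ?_⟩
    · simpa using M.sub_mem h₁ h₂
    · simpa using M.sub_mem h₂ h₃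
    · have h := N.add_mem hsum.2 (N.add_mem (N.add_mem hy hy) hy)
      convert h using 1
      abel
  · rintro ⟨h₁₂, h₂₃, hsum⟩
    obtain ⟨x, hx, y, hy, rfl⟩ := Submodule.mem_sup.mp (hMN ▸ Submodule.mem_top : c₁ ∈ M ⊔ N)
    have h₂ : c₂ - y ∈ M := by
      convert M.sub_mem hx h₁₂ using 1
      abel
    have h₃ : c₃ - y ∈ M := by
      convert M.sub_mem h₂ h₂₃ using 1
      abel
    refine ⟨y, hy, x, hx, c₂ - y, h₂, c₃ - y, h₃, ⟨M.add_mem (M.add_mem hx h₂) h₃, ?_⟩,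
      rfl, (sub_add_cancel c₂ y).symm, (sub_add_cancel c₃ y).symm⟩
    change x + (c₂ - y) + (c₃ - y) ∈ N
    have h := N.sub_mem hsum (N.add_mem (N.add_mem hy hy) hy)
    convert h using 1
    abel
end

section
/- Let L be a ℤ-module and A : L → L an endomorphism satisfying A ∘ (id − A) = 2·id. Set M := (id − A)(L) and N := A(L). Then the subgroup Γ := {(c₁,c₂,c₃) ∈ L³ : c₁ − c₂ ∈ M, c₂ − c₃ ∈ M, c₁ + c₂ + c₃ ∈ N} of L³ is generated, as a ℤ-module, by the elements (ℓ, ℓ, Aℓ), (0, ℓ − Aℓ, ℓ − Aℓ), and (0, 0, 2ℓ) for ℓ ∈ L. -/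
/-- For `A : L → L` with `A ∘ (id - A) = 2·id`, `M := (id-A)(L)`, `N := A(L)`, the
lattice `Γ = {(c₁,c₂,c₃) ∈ L³ : c₁-c₂ ∈ M, c₂-c₃ ∈ M, c₁+c₂+c₃ ∈ N}` is generated as a
`ℤ`-module by the elements `(ℓ,ℓ,Aℓ)`, `(0,ℓ-Aℓ,ℓ-Aℓ)` and `(0,0,2ℓ)` for `ℓ ∈ L`. -/
theorem stmt14 {L : Type*} [AddCommGroup L] [Module ℤ L]
    (A : L →ₗ[ℤ] L) (hA : ∀ x, A (x - A x) = (2 : ℤ) • x) :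
    (Submodule.span ℤ ({p : L × L × L | ∃ ℓ : L,
        p = (ℓ, ℓ, A ℓ) ∨ p = (0, ℓ - A ℓ, ℓ - A ℓ) ∨ p = (0, 0, (2 : ℤ) • ℓ)}) :
      Set (L × L × L)) =
    {p : L × L × L | p.1 - p.2.1 ∈ LinearMap.range (LinearMap.id - A) ∧
      p.2.1 - p.2.2 ∈ LinearMap.range (LinearMap.id - A) ∧
      p.1 + p.2.1 + p.2.2 ∈ LinearMap.range A} := by
  obtain rfl : ‹Module ℤ L› = AddCommGroup.toIntModule L := Subsingleton.elim _ _
  have hAA : ∀ x, A (A x) = A x - (x + x) := fun x => by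
    have h := hA x
    rw [map_sub, two_zsmul] at h
    rw [← h, sub_sub_cancel]
  ext ⟨c₁, c₂, c₃⟩
  simp only [SetLike.mem_coe, Set.mem_ofPred_eq]
  constructor
  · let f₁ : L × L × L →+ L := AddMonoidHom.fst L (L × L)
    let f₂ : L × L × L →+ L := (AddMonoidHom.fst L L).comp (AddMonoidHom.snd L (L × L))
    let f₃ : L × L × L →+ L := (AddMonoidHom.snd L L).comp (AddMonoidHom.snd L (L × L))
    have hle : Submodule.span ℤ ({p : L × L × L | ∃ ℓ : L,
        p = (ℓ, ℓ, A ℓ) ∨ p = (0, ℓ - A ℓ, ℓ - A ℓ) ∨ p = (0, 0, (2 : ℤ) • ℓ)}) ≤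
        (LinearMap.range (LinearMap.id - A)).comap (f₁ - f₂).toIntLinearMap ⊓
          ((LinearMap.range (LinearMap.id - A)).comap (f₂ - f₃).toIntLinearMap ⊓
            (LinearMap.range A).comap (f₁ + f₂ + f₃).toIntLinearMap) := by
      rw [Submodule.span_le]
      rintro _ ⟨ℓ, rfl | rfl | rfl⟩
      · refine ⟨⟨0, ?_⟩, ⟨ℓ, ?_⟩, ⟨ℓ - A ℓ + ℓ, ?_⟩⟩ <;> simp [f₁, f₂, f₃, hAA]
      · refine ⟨⟨-ℓ, ?_⟩, ⟨0, ?_⟩, ⟨ℓ - A ℓ - A (ℓ - A ℓ), ?_⟩⟩ <;> simp [f₁, f₂, f₃, hAA] <;> abel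
      · refine ⟨⟨0, ?_⟩, ⟨-A ℓ, ?_⟩, ⟨ℓ - A ℓ, ?_⟩⟩ <;> simp [f₁, f₂, f₃, hAA, two_zsmul]
        abel
    exact fun h => hle h
  · rintro ⟨⟨p, hp⟩, ⟨q, hq⟩, ⟨r, hr⟩⟩
    simp only [LinearMap.sub_apply, LinearMap.id_apply] at hp hq
    obtain rfl : c₂ = c₁ - (p - A p) := by rw [hp, sub_sub_cancel]
    obtain rfl : c₃ = c₁ - (p - A p) - (q - A q) := by rw [hq, sub_sub_cancel]
    have hr' := congrArg A hr
    simp only [map_add, map_sub, hAA] at hr'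
    have key : (c₁, c₁ - (p - A p), c₁ - (p - A p) - (q - A q)) =
        (c₁, c₁, A c₁) + (0, -p - A (-p), -p - A (-p)) +
          (0, 0, (2 : ℤ) • (r - q - (c₁ - A c₁) + (p - A p - A (p - A p)))) := by
      simp only [Prod.mk_add_mk, Prod.mk.injEq, map_neg, map_sub, hAA, two_zsmul]
      refine ⟨by abel, by abel, ?_⟩
      linear_combination (norm := abel) hr' - hr
    rw [key]
    exact add_mem (add_mem (Submodule.subset_span ⟨c₁, .inl rfl⟩)
      (Submodule.subset_span ⟨-p, .inr (.inl rfl)⟩)) (Submodule.subset_span ⟨_, .inr (.inr rfl)⟩)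
end

section
/- Let E be a real inner product space and L a ℤ-submodule with ⟨ℓ,ℓ⟩ ≥ 4 for every nonzero ℓ ∈ L. Let M, N ⊆ L be submodules with M + N = L, M ∩ N = 2L, ⟨m,m⟩ ≥ 8 for every nonzero m ∈ M and ⟨n,n⟩ ≥ 8 for every nonzero n ∈ N. Let Γ := {(c₁,c₂,c₃) ∈ L³ : c₁ − c₂ ∈ M, c₂ − c₃ ∈ M, c₁+c₂+c₃ ∈ N}. Then every nonzero (γ₁,γ₂,γ₃) ∈ Γ satisfies ⟨γ₁,γ₁⟩ + ⟨γ₂,γ₂⟩ + ⟨γ₃,γ₃⟩ ≥ 12, and if equality holds then ⟨γ_i,γ_i⟩ = 4 for each i = 1,2,3. -/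
open RealInnerProductSpace

/-- A nonzero element of `2L` has norm at least 16 when `L` has minimum at least 4. -/
lemma sixteen_le_inner_of_mem_two_smul {E : Type*} [NormedAddCommGroup E]
    [InnerProductSpace ℝ E] {L : Submodule ℤ E}
    (hminL : ∀ ℓ ∈ L, ℓ ≠ 0 → (4 : ℝ) ≤ ⟪ℓ, ℓ⟫) {x : E}
    (hx : ∃ ℓ ∈ L, x = (2 : ℤ) • ℓ) (hx0 : x ≠ 0) : (16 : ℝ) ≤ ⟪x, x⟫ := by
  obtain ⟨ℓ, hℓ, rfl⟩ := hx
  have h := hminL ℓ hℓ (by rintro rfl; simp at hx0)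
  rw [two_smul, inner_add_left, inner_add_right]
  linarith

/-- Two elements of `M`, not both zero, whose sum lies in `N` have total norm at least 16. -/
lemma sixteen_le_inner_add_inner {E : Type*} [NormedAddCommGroup E]
    [InnerProductSpace ℝ E] {L M N : Submodule ℤ E}
    (hminL : ∀ ℓ ∈ L, ℓ ≠ 0 → (4 : ℝ) ≤ ⟪ℓ, ℓ⟫)
    (hcap : ∀ x : E, x ∈ M ⊓ N → ∃ ℓ ∈ L, x = (2 : ℤ) • ℓ)
    (hminM : ∀ m ∈ M, m ≠ 0 → (8 : ℝ) ≤ ⟪m, m⟫)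
    {a b : E} (ha : a ∈ M) (hb : b ∈ M) (hab : a + b ∈ N) (h0 : ¬(a = 0 ∧ b = 0)) :
    (16 : ℝ) ≤ ⟪a, a⟫ + ⟪b, b⟫ := by
  by_cases ha0 : a = 0
  · subst ha0
    have := sixteen_le_inner_of_mem_two_smul hminL (hcap b ⟨hb, by simpa using hab⟩)
      (fun h => h0 ⟨rfl, h⟩)
    simpa using this
  · by_cases hb0 : b = 0
    · subst hb0
      have := sixteen_le_inner_of_mem_two_smul hminL (hcap a ⟨ha, by simpa using hab⟩) ha0
      simpa using this
    · linarith [hminM a ha ha0, hminM b hb hb0]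

/-- `L(M,N,3)` for a polarisation of a Leech-like lattice has minimum (total norm) at
least 12, and in case of equality all three components have norm 4. -/
theorem stmt15 {E : Type*} [NormedAddCommGroup E] [InnerProductSpace ℝ E]
    (L M N : Submodule ℤ E)
    (hminL : ∀ ℓ ∈ L, ℓ ≠ 0 → (4 : ℝ) ≤ ⟪ℓ, ℓ⟫)
    (hMN : M ⊔ N = L)
    (hcap : ∀ x : E, x ∈ M ⊓ N ↔ ∃ ℓ ∈ L, x = (2 : ℤ) • ℓ)
    (hminM : ∀ m ∈ M, m ≠ 0 → (8 : ℝ) ≤ ⟪m, m⟫)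
    (hminN : ∀ n ∈ N, n ≠ 0 → (8 : ℝ) ≤ ⟪n, n⟫)
    (Γ : Set (E × E × E))
    (hΓ : Γ = {c | c.1 ∈ L ∧ c.2.1 ∈ L ∧ c.2.2 ∈ L ∧
      c.1 - c.2.1 ∈ M ∧ c.2.1 - c.2.2 ∈ M ∧ c.1 + c.2.1 + c.2.2 ∈ N}) :
    ∀ γ ∈ Γ, γ ≠ 0 →
      (12 : ℝ) ≤ ⟪γ.1, γ.1⟫ + ⟪γ.2.1, γ.2.1⟫ + ⟪γ.2.2, γ.2.2⟫ ∧
      (⟪γ.1, γ.1⟫ + ⟪γ.2.1, γ.2.1⟫ + ⟪γ.2.2, γ.2.2⟫ = 12 →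
        ⟪γ.1, γ.1⟫ = 4 ∧ ⟪γ.2.1, γ.2.1⟫ = 4 ∧ ⟪γ.2.2, γ.2.2⟫ = 4) := by
  subst hΓ
  rintro ⟨a, b, c⟩ ⟨ha, hb, hc, hab, hbc, hsum⟩ h0
  dsimp only at ha hb hc hab hbc hsum ⊢
  have key {x y : E} (hx : x ∈ M) (hy : y ∈ M) (hxy : x + y ∈ N) (h : ¬(x = 0 ∧ y = 0)) :
      (16 : ℝ) ≤ ⟪x, x⟫ + ⟪y, y⟫ :=
    sixteen_le_inner_add_inner hminL (fun z => (hcap z).1) hminM hx hy hxy h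
  by_cases ha0 : a = 0
  · subst ha0
    have hbM : b ∈ M := by simpa using hab
    have hcM : c ∈ M := by simpa using M.sub_mem hbM hbc
    have h := key hbM hcM (by simpa using hsum) (by rintro ⟨rfl, rfl⟩; exact h0 rfl)
    rw [inner_zero_left]
    constructor <;> intros <;> linarith
  by_cases hb0 : b = 0
  · subst hb0
    have h := key (by simpa using hab) (by simpa using hbc) (by simpa using hsum)
      (fun h => ha0 h.1)
    rw [inner_zero_left]
    constructor <;> intros <;> linarith
  by_cases hc0 : c = 0
  · subst hc0
    have hbM : b ∈ M := by simpa using hbc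
    have haM : a ∈ M := by simpa using M.add_mem hab hbM
    have h := key haM hbM (by simpa using hsum) (fun h => ha0 h.1)
    rw [inner_zero_left]
    constructor <;> intros <;> linarith
  have h₁ := hminL a ha ha0
  have h₂ := hminL b hb hb0
  have h₃ := hminL c hc hc0
  exact ⟨by linarith, fun h => ⟨by linarith, by linarith, by linarith⟩⟩
end

section
/- Let E be a real inner product space and L a ℤ-submodule with ⟨ℓ,ℓ⟩ ∈ 2ℤ and ⟨ℓ,ℓ⟩ ≥ 4 for every nonzero ℓ ∈ L. Let M, N ⊆ L be submodules with M + N = L, M ∩ N = 2L, ⟨m,m⟩ ≥ 8 for every nonzero m ∈ M and ⟨n,n⟩ ≥ 8 for every nonzero n ∈ N. Let Γ := {(c₁,c₂,c₃) ∈ L³ : c₁ − c₂ ∈ M, c₂ − c₃ ∈ M, c₁+c₂+c₃ ∈ N}. If (γ₁,γ₂,γ₃) ∈ Γ satisfies ⟨γ₁,γ₁⟩ + ⟨γ₂,γ₂⟩ + ⟨γ₃,γ₃⟩ = 16, then the multiset {⟨γ₁,γ₁⟩, ⟨γ₂,γ₂⟩, ⟨γ₃,γ₃⟩} is one of {16,0,0},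 {8,8,0}, {8,4,4}, {6,6,4}. -/
open RealInnerProductSpace

/-- Three nonnegative integers with sum 8, none equal to 1, such that when one of them is zero
the other two are zero or at least 4, form one of four multisets. -/
theorem half_norm_types {a b c : ℤ} (hsum : a + b + c = 8)
    (ha : a = 0 ∨ 2 ≤ a) (hb : b = 0 ∨ 2 ≤ b) (hc : c = 0 ∨ 2 ≤ c)
    (hab : a = 0 → b = 0 ∨ 4 ≤ b) (hac : a = 0 → c = 0 ∨ 4 ≤ c)
    (hba : b = 0 → a = 0 ∨ 4 ≤ a) (hbc : b = 0 → c = 0 ∨ 4 ≤ c)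
    (hca : c = 0 → a = 0 ∨ 4 ≤ a) (hcb : c = 0 → b = 0 ∨ 4 ≤ b) :
    ({a, b, c} : Multiset ℤ) = {8, 0, 0} ∨ ({a, b, c} : Multiset ℤ) = {4, 4, 0} ∨
    ({a, b, c} : Multiset ℤ) = {4, 2, 2} ∨ ({a, b, c} : Multiset ℤ) = {3, 3, 2} := by
  have ha0 : 0 ≤ a := by omega
  have ha8 : a ≤ 8 := by omega
  have hb0 : 0 ≤ b := by omega
  have hb8 : b ≤ 8 := by omega
  obtain rfl : c = 8 - a - b := by omega
  interval_cases a <;> interval_cases b <;> first | omega | decide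

/-- The possible component-norm types of the vectors of total norm 16 in `L(M,N,3)`
for a polarisation of a Leech-like even lattice: `{16,0,0}`, `{8,8,0}`, `{8,4,4}` or
`{6,6,4}`. -/
theorem stmt16 {E : Type*} [NormedAddCommGroup E] [InnerProductSpace ℝ E]
    (L M N : Submodule ℤ E)
    (hevenL : ∀ ℓ ∈ L, ∃ n : ℤ, ⟪ℓ, ℓ⟫ = 2 * n)
    (hminL : ∀ ℓ ∈ L, ℓ ≠ 0 → (4 : ℝ) ≤ ⟪ℓ, ℓ⟫)
    (hMN : M ⊔ N = L)
    (hcap : ∀ x : E, x ∈ M ⊓ N ↔ ∃ ℓ ∈ L, x = (2 : ℤ) • ℓ)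
    (hminM : ∀ m ∈ M, m ≠ 0 → (8 : ℝ) ≤ ⟪m, m⟫)
    (hminN : ∀ n ∈ N, n ≠ 0 → (8 : ℝ) ≤ ⟪n, n⟫)
    (Γ : Set (E × E × E))
    (hΓ : Γ = {c | c.1 ∈ L ∧ c.2.1 ∈ L ∧ c.2.2 ∈ L ∧
      c.1 - c.2.1 ∈ M ∧ c.2.1 - c.2.2 ∈ M ∧ c.1 + c.2.1 + c.2.2 ∈ N}) :
    ∀ γ ∈ Γ, ⟪γ.1, γ.1⟫ + ⟪γ.2.1, γ.2.1⟫ + ⟪γ.2.2, γ.2.2⟫ = 16 →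
      ({⟪γ.1, γ.1⟫, ⟪γ.2.1, γ.2.1⟫, ⟪γ.2.2, γ.2.2⟫} : Multiset ℝ) = {16, 0, 0} ∨
      ({⟪γ.1, γ.1⟫, ⟪γ.2.1, γ.2.1⟫, ⟪γ.2.2, γ.2.2⟫} : Multiset ℝ) = {8, 8, 0} ∨
      ({⟪γ.1, γ.1⟫, ⟪γ.2.1, γ.2.1⟫, ⟪γ.2.2, γ.2.2⟫} : Multiset ℝ) = {8, 4, 4} ∨
      ({⟪γ.1, γ.1⟫, ⟪γ.2.1, γ.2.1⟫, ⟪γ.2.2, γ.2.2⟫} : Multiset ℝ) = {6, 6, 4} := by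
  subst hΓ
  rintro ⟨x, y, z⟩ ⟨hx, hy, hz, hxy, hyz, -⟩ hsum
  dsimp only at hx hy hz hxy hyz hsum ⊢
  have hxz : x - z ∈ M := by simpa using add_mem hxy hyz
  have half_min {v : E} {n : ℤ} (hv : v ∈ L) (hn : ⟪v, v⟫ = 2 * (n : ℝ)) : n = 0 ∨ 2 ≤ n := by
    by_cases h : v = 0
    · left
      simpa [h] using hn.symm
    · right
      have := hminL v hv h
      exact_mod_cast (by linarith : (2 : ℝ) ≤ n)
  have half_min_of_zero {v w : E} {m n : ℤ} (hvw : v - w ∈ M) (hm : ⟪v, v⟫ = 2 * (m : ℝ))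
      (hn : ⟪w, w⟫ = 2 * (n : ℝ)) (h0 : m = 0) : n = 0 ∨ 4 ≤ n := by
    obtain rfl : v = 0 := by
      rw [h0] at hm
      simpa using hm
    by_cases h : w = 0
    · left
      simpa [h] using hn.symm
    · right
      have := hminM w (by simpa using hvw) h
      exact_mod_cast (by linarith : (4 : ℝ) ≤ n)
  obtain ⟨a, ha⟩ := hevenL x hx
  obtain ⟨b, hb⟩ := hevenL y hy
  obtain ⟨c, hc⟩ := hevenL z hz
  have habc : a + b + c = 8 := by
    exact_mod_cast (by linarith : (a : ℝ) + b + c = 8)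
  have types := half_norm_types habc (half_min hx ha) (half_min hy hb) (half_min hz hc)
    (half_min_of_zero hxy ha hb) (half_min_of_zero hxz ha hc)
    (half_min_of_zero (sub_mem_comm_iff.mp hxy) hb ha) (half_min_of_zero hyz hb hc)
    (half_min_of_zero (sub_mem_comm_iff.mp hxz) hc ha)
    (half_min_of_zero (sub_mem_comm_iff.mp hyz) hc hb)
  rw [ha, hb, hc]
  refine types.imp ?_ (Or.imp ?_ (Or.imp ?_ ?_)) <;> intro h <;>
    convert congrArg (Multiset.map fun n : ℤ => 2 * (n : ℝ)) h using 1 <;>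
    norm_num
end

section
/- Let E be a finite-dimensional real inner product space and L a full even unimodular ℤ-lattice in E. Let w ∈ E with w ∉ L, 2w ∈ L, and ⟨w,w⟩ ∈ 2ℤ. Set L_w := {ℓ ∈ L : ⟨w,ℓ⟩ ∈ ℤ} and L^w := L_w + ℤw. Then L^w is again a full even unimodular ℤ-lattice in E: ⟨v,v⟩ ∈ 2ℤ for all v ∈ L^w, and {v ∈ E : ⟨v,u⟩ ∈ ℤ for all u ∈ L^w} = L^w. -/
open RealInnerProductSpace

/-- Two half-integers, neither of them an integer, differ by an integer. -/
theorem exists_int_eq_sub_of_two_mul {a b : ℝ} (ha : ∃ n : ℤ, 2 * a = n) (hb : ∃ n : ℤ, 2 * b = n)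
    (ha' : ¬ ∃ n : ℤ, a = n) (hb' : ¬ ∃ n : ℤ, b = n) : ∃ n : ℤ, a - b = n := by
  obtain ⟨p, hp⟩ := ha
  obtain ⟨q, hq⟩ := hb
  rcases Int.even_or_odd' p with ⟨k, rfl | rfl⟩
  · exact absurd ⟨k, by push_cast at hp; linarith⟩ ha'
  rcases Int.even_or_odd' q with ⟨l, rfl | rfl⟩
  · exact absurd ⟨l, by push_cast at hq; linarith⟩ hb'
  exact ⟨k - l, by push_cast at hp hq ⊢; linarith⟩

/-- The even 2-neighbour construction: for a full even unimodular lattice `L` and `w ∉ L`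
with `2w ∈ L` and `⟨w,w⟩ ∈ 2ℤ`, the lattice `L^w = L_w + ℤw` (where
`L_w = {ℓ ∈ L : ⟨w,ℓ⟩ ∈ ℤ}`) is again a full even unimodular lattice. -/
theorem stmt17 {E : Type*} [NormedAddCommGroup E] [InnerProductSpace ℝ E]
    [FiniteDimensional ℝ E]
    (L : Submodule ℤ E)
    (hdisc : DiscreteTopology L)
    (hfull : Submodule.span ℝ (L : Set E) = ⊤)
    (heven : ∀ ℓ ∈ L, ∃ n : ℤ, ⟪ℓ, ℓ⟫ = 2 * n)
    (hunimod : ∀ v : E, (∀ ℓ ∈ L, ∃ n : ℤ, ⟪v, ℓ⟫ = n) ↔ v ∈ L)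
    (w : E) (hw : w ∉ L) (h2w : (2 : ℤ) • w ∈ L)
    (hww : ∃ n : ℤ, ⟪w, w⟫ = 2 * n)
    (Lup : Set E)
    (hLup : Lup = {v | ∃ ℓ ∈ L, (∃ n : ℤ, ⟪w, ℓ⟫ = n) ∧ ∃ m : ℤ, v = ℓ + m • w}) :
    DiscreteTopology Lup ∧
    Submodule.span ℝ Lup = ⊤ ∧
    (∀ v ∈ Lup, ∃ n : ℤ, ⟪v, v⟫ = 2 * n) ∧
    {v : E | ∀ u ∈ Lup, ∃ n : ℤ, ⟪v, u⟫ = n} = Lup := by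
  have hint : ∀ v ∈ L, ∀ ℓ ∈ L, ∃ n : ℤ, ⟪v, ℓ⟫ = n := fun v hv => (hunimod v).2 hv
  have inner_two (x y : E) : ⟪x, (2 : ℤ) • y⟫ = 2 * ⟪x, y⟫ := by
    rw [two_smul, inner_add_right, two_mul]
  have inner_int (x y : E) (m : ℤ) : ⟪x, m • y⟫ = m * ⟪x, y⟫ := by
    rw [← Int.cast_smul_eq_zsmul ℝ, real_inner_smul_right]
  have h2int : ∀ ℓ ∈ L, ∃ n : ℤ, 2 * ⟪w, ℓ⟫ = n := fun ℓ hℓ => by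
    obtain ⟨n, hn⟩ := hint ℓ hℓ _ h2w
    exact ⟨n, by rw [← hn, inner_two, real_inner_comm]⟩
  have hmem : ∀ ℓ ∈ L, (∃ n : ℤ, ⟪w, ℓ⟫ = n) → ℓ ∈ Lup := fun ℓ hℓ hn => by
    rw [hLup]
    exact ⟨ℓ, hℓ, hn, 0, by simp⟩
  have hmem2 : ∀ ℓ ∈ L, (2 : ℤ) • ℓ ∈ Lup := fun ℓ hℓ =>
    hmem _ (L.smul_mem _ hℓ) (by rw [inner_two]; exact h2int ℓ hℓ)
  have hmemw : w ∈ Lup := by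
    rw [hLup]
    exact ⟨0, L.zero_mem, ⟨0, by simp⟩, 1, by simp⟩
  have hdouble : ∀ v ∈ Lup, (2 : ℤ) • v ∈ L := by
    rw [hLup]
    rintro _ ⟨ℓ, hℓ, -, m, rfl⟩
    rw [smul_add, smul_comm]
    exact L.add_mem (L.smul_mem _ hℓ) (L.smul_mem _ h2w)
  obtain ⟨c, hc⟩ := hww
  refine ⟨?_, ?_, ?_, Set.Subset.antisymm ?_ ?_⟩
  · refine DiscreteTopology.of_continuous_injective
      (f := fun v : Lup => (⟨(2 : ℤ) • (v : E), hdouble v v.2⟩ : L)) (by fun_prop) ?_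
    intro x y hxy
    have hxy' : (2 : ℤ) • (x : E) = (2 : ℤ) • (y : E) := congrArg Subtype.val hxy
    rw [← Int.cast_smul_eq_zsmul ℝ, ← Int.cast_smul_eq_zsmul ℝ] at hxy'
    exact Subtype.ext (smul_right_injective E (by norm_num : ((2 : ℤ) : ℝ) ≠ 0) hxy')
  · rw [eq_top_iff, ← hfull, Submodule.span_le]
    intro ℓ hℓ
    have h := Submodule.smul_mem _ (2⁻¹ : ℝ) (Submodule.subset_span (R := ℝ) (hmem2 ℓ hℓ))
    rwa [← Int.cast_smul_eq_zsmul ℝ, smul_smul, Int.cast_ofNat, inv_mul_cancel₀ two_ne_zero,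
      one_smul] at h
  · rw [hLup]
    rintro _ ⟨ℓ, hℓ, ⟨b, hb⟩, m, rfl⟩
    obtain ⟨a, ha⟩ := heven ℓ hℓ
    refine ⟨a + m * b + m ^ 2 * c, ?_⟩
    rw [real_inner_add_add_self, real_inner_comm (m • w) (m • w), inner_int, inner_int,
      real_inner_comm w (m • w), inner_int, real_inner_comm w ℓ, ha, hb, hc]
    push_cast
    ring
  · intro v hv
    obtain ⟨e, he⟩ := hv w hmemw
    have hw' : ¬ ∀ ℓ ∈ L, ∃ n : ℤ, ⟪w, ℓ⟫ = n := fun h => hw ((hunimod w).1 h)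
    push Not at hw'
    obtain ⟨k, hk, hkw⟩ := hw'
    have hkw : ¬ ∃ n : ℤ, ⟪w, k⟫ = n := fun ⟨n, hn⟩ => hkw n hn
    -- A vector pairing integrally with `L_w` and with `k` pairs integrally with `L`.
    have key (x : E) (hx : ∀ ℓ ∈ L, (∃ n : ℤ, ⟪w, ℓ⟫ = n) → ∃ n : ℤ, ⟪x, ℓ⟫ = n)
        (hxk : ∃ n : ℤ, ⟪x, k⟫ = n) : x ∈ L := by
      refine (hunimod x).1 fun ℓ hℓ => ?_
      by_cases h : ∃ n : ℤ, ⟪w, ℓ⟫ = n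
      · exact hx ℓ hℓ h
      · obtain ⟨p, hp⟩ := hx (ℓ - k) (L.sub_mem hℓ hk) (by
          rw [inner_sub_right]
          exact exists_int_eq_sub_of_two_mul (h2int ℓ hℓ) (h2int k hk) h hkw)
        obtain ⟨q, hq⟩ := hxk
        rw [inner_sub_right] at hp
        exact ⟨p + q, by push_cast; linarith⟩
    by_cases hvk : ∃ n : ℤ, ⟪v, k⟫ = n
    · exact hmem v (key v (fun ℓ hℓ h => hv ℓ (hmem ℓ hℓ h)) hvk)
        ⟨e, by rw [real_inner_comm, he]⟩
    · have hvw : v - w ∈ L := by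
        refine key _ (fun ℓ hℓ h => ?_) ?_
        · obtain ⟨p, hp⟩ := hv ℓ (hmem ℓ hℓ h)
          obtain ⟨q, hq⟩ := h
          exact ⟨p - q, by rw [inner_sub_left, hp, hq]; push_cast; rfl⟩
        · rw [inner_sub_left]
          exact exists_int_eq_sub_of_two_mul (by rw [← inner_two]; exact hv _ (hmem2 k hk))
            (h2int k hk) hvk hkw
      rw [hLup]
      refine ⟨v - w, hvw, ⟨e - 2 * c, ?_⟩, 1, by simp⟩
      rw [inner_sub_right, real_inner_comm, he, hc]
      push_cast
      rfl
  · intro v hv u hu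
    rw [hLup] at hv hu
    obtain ⟨ℓ, hℓ, ⟨b, hb⟩, m, rfl⟩ := hv
    obtain ⟨ℓ', hℓ', ⟨b', hb'⟩, m', rfl⟩ := hu
    obtain ⟨a, ha⟩ := hint ℓ hℓ ℓ' hℓ'
    refine ⟨a + m' * b + m * b' + m * m' * (2 * c), ?_⟩
    rw [inner_add_left, inner_add_right, inner_add_right, inner_int, inner_int,
      real_inner_comm ℓ' (m • w), inner_int, real_inner_comm w (m • w), inner_int,
      real_inner_comm w ℓ, real_inner_comm w ℓ', ha, hb, hb', hc]
    push_cast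
    ring
end

section
/- Let E be a real inner product space with an orthogonal direct sum decomposition E = E₁ ⊕ E₂, with orthogonal projections π₁ onto E₁ and π₂ onto E₂, and let Γ be a ℤ-submodule of E. Assume: ⟨v,v⟩ ≥ 8 for every nonzero v ∈ Γ ∩ E₁ and every nonzero v ∈ Γ ∩ E₂; ⟨x,x⟩ ≥ 2 for every nonzero x ∈ π₁(Γ); and ⟨y,y⟩ ≥ 4 for every nonzero y ∈ π₂(Γ). Then every v ∈ Γ with ⟨v,v⟩ = 6 satisfies ⟨π₁(v),π₁(v)⟩ = 2 and ⟨π₂(v),π₂(v)⟩ = 4. -/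
open RealInnerProductSpace

/-- Orthogonal decomposition method: if `K₁ = Γ ∩ E₁` and `K₂ = Γ ∩ E₂` have minimum 8,
`π₁(Γ)` has minimum 2 and `π₂(Γ)` has minimum 4, then every vector of norm 6 in `Γ`
projects to a norm-2 vector in `E₁` and a norm-4 vector in `E₂`. -/
theorem stmt19 {E : Type*} [NormedAddCommGroup E] [InnerProductSpace ℝ E]
    (E₁ E₂ : Submodule ℝ E)
    (horth : ∀ x ∈ E₁, ∀ y ∈ E₂, ⟪x, y⟫ = 0)
    (π₁ π₂ : E →ₗ[ℝ] E)
    (hr₁ : ∀ v : E, π₁ v ∈ E₁) (hr₂ : ∀ v : E, π₂ v ∈ E₂)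
    (hsum : ∀ v : E, π₁ v + π₂ v = v)
    (Γ : Submodule ℤ E)
    (hK₁ : ∀ v ∈ (Γ : Set E) ∩ (E₁ : Set E), v ≠ 0 → (8 : ℝ) ≤ ⟪v, v⟫)
    (hK₂ : ∀ v ∈ (Γ : Set E) ∩ (E₂ : Set E), v ≠ 0 → (8 : ℝ) ≤ ⟪v, v⟫)
    (hI₁ : ∀ x ∈ π₁ '' (Γ : Set E), x ≠ 0 → (2 : ℝ) ≤ ⟪x, x⟫)
    (hI₂ : ∀ y ∈ π₂ '' (Γ : Set E), y ≠ 0 → (4 : ℝ) ≤ ⟪y, y⟫) :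
    ∀ v ∈ Γ, ⟪v, v⟫ = 6 → ⟪π₁ v, π₁ v⟫ = 2 ∧ ⟪π₂ v, π₂ v⟫ = 4 := by
  intro v hv h6
  have hv0 : v ≠ 0 := by
    rintro rfl
    simp at h6
  have h₁ : π₁ v ≠ 0 := by
    intro h
    have hmem : v ∈ E₂ := by
      have h' := hsum v
      rw [h, zero_add] at h'
      exact h' ▸ hr₂ v
    linarith [hK₂ v ⟨hv, hmem⟩ hv0]
  have h₂ : π₂ v ≠ 0 := by
    intro h
    have hmem : v ∈ E₁ := by
      have h' := hsum v
      rw [h, add_zero] at h'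
      exact h' ▸ hr₁ v
    linarith [hK₁ v ⟨hv, hmem⟩ hv0]
  have hpyth : ⟪v, v⟫ = ⟪π₁ v, π₁ v⟫ + ⟪π₂ v, π₂ v⟫ := by
    conv_lhs => rw [← hsum v]
    rw [real_inner_add_add_self, horth _ (hr₁ v) _ (hr₂ v)]
    ring
  have hle₁ := hI₁ _ ⟨v, hv, rfl⟩ h₁
  have hle₂ := hI₂ _ ⟨v, hv, rfl⟩ h₂
  constructor <;> linarith
end
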